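/- (Proposition 4.1, concentration part) Suppose Y = (Y₁,…,Y_n) consists of independent random variables with 0 ≤ Y_i ≤ 1 for all i, and let g₁,…,g_n ∈ ℝ be fixed. Then for every q ∈ [1,∞] and every t ≥ 0, P{ ‖(1/n)∑_{i=1}^n X_i (Y_i − g_i)‖_q ≥ E[‖(1/n)∑_{i=1}^n X_i (Y_i − g_i)‖_q] + t } ≤ exp( −n t² / (2 N_q(X)²) ). -/

import Mathlib

open MeasureTheory ProbabilityTheory
open scoped ENNReal NNReal

noncomputable def lqNorm (q : ℝ≥0∞) {L : ℕ} (v : Fin L → ℝ) : ℝ :=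
  (eLpNorm v q Measure.count).toReal

noncomputable def Nq (q : ℝ≥0∞) {n L : ℕ} (X : Fin n → Fin L → ℝ) : ℝ :=
  lqNorm q (fun j => Real.sqrt ((1 / (n : ℝ)) * ∑ i, (X i j) ^ 2))

noncomputable def gaussianVec (n : ℕ) (σ : ℝ) : Measure (Fin n → ℝ) :=
  Measure.pi (fun _ => gaussianReal 0 ⟨σ ^ 2, sq_nonneg σ⟩)

lemma aux_exp {u : ℝ} (hu : 0 ≤ u) : ∃ s : ℝ, 0 ≤ s ∧ s ≤ 1 ∧
    Real.exp (u - s * u + s ^ 2 / 2) ≤ 1 + u := by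
  have key : ∀ v : ℝ, 0 ≤ v → Real.exp (v - v ^ 2 / 2) ≤ 1 + v := by
    intro v hv
    rw [← Real.le_log_iff_exp_le (by linarith)]
    refine le_trans ?_ (Real.le_log_one_add_of_nonneg hv)
    rw [le_div_iff₀ (by linarith)]
    nlinarith [pow_nonneg hv 3]
  rcases le_total u 1 with h | h
  · refine ⟨u, hu, h, ?_⟩
    have := key u hu
    rwa [show u - u * u + u ^ 2 / 2 = u - u ^ 2 / 2 by ring]
  · refine ⟨1, by norm_num, le_refl _, ?_⟩
    have := key 1 (by norm_num)
    rw [show u - 1 * u + 1 ^ 2 / 2 = 1 - 1 ^ 2 / (2:ℝ) by ring]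
    linarith

lemma convex_cont {E : Type*} [NormedAddCommGroup E] [NormedSpace ℝ E] [FiniteDimensional ℝ E]
    {f : E → ℝ} (hf : ConvexOn ℝ Set.univ f) : Continuous f :=
  continuousOn_univ.1 (hf.continuousOn isOpen_univ)

lemma integrable_of_cpt {E : Type*} [TopologicalSpace E] [MeasurableSpace E] [BorelSpace E]
    {μ : Measure E} [IsFiniteMeasure μ] {K : Set E} (hK : IsCompact K)
    (hμ : ∀ᵐ x ∂μ, x ∈ K) {f : E → ℝ} (hf : Continuous f) : Integrable f μ := by
  obtain ⟨C, hC⟩ := hK.exists_bound_of_continuousOn hf.continuousOn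
  refine Integrable.of_bound hf.measurable.aestronglyMeasurable C ?_
  filter_upwards [hμ] with x hx using hC x hx

lemma one_dim (μ : Measure ℝ) [IsProbabilityMeasure μ] (hμ : ∀ᵐ x ∂μ, x ∈ Set.Icc (0:ℝ) 1)
    (F : ℝ → ℝ) (hF : ConvexOn ℝ Set.univ F) (H : ℝ → ℝ≥0∞)
    (h : ∀ x ∈ Set.Icc (0:ℝ) 1, ∀ y ∈ Set.Icc (0:ℝ) 1,
      H x ≤ ENNReal.ofReal (Real.exp (F y + (x - y) ^ 2 / 2))) :
    ∫⁻ x, H x ∂μ ≤ ENNReal.ofReal (Real.exp (∫ x, F x ∂μ)) := by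
  have hc := convex_cont hF
  have hint : Integrable F μ := integrable_of_cpt isCompact_Icc hμ hc
  obtain ⟨y0, hy0, hmin⟩ := isCompact_Icc.exists_isMinOn
    (Set.nonempty_Icc.2 (zero_le_one (α := ℝ))) hc.continuousOn
  have hmin' : ∀ x ∈ Set.Icc (0:ℝ) 1, F y0 ≤ F x := fun x hx => hmin hx
  set a := F y0 with ha
  have step : ∀ x ∈ Set.Icc (0:ℝ) 1,
      H x ≤ ENNReal.ofReal (Real.exp a * (1 + (F x - a))) := by
    intro x hx
    have hu : 0 ≤ F x - a := by linarith [hmin' x hx]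
    obtain ⟨s, hs0, hs1, hs⟩ := aux_exp hu
    have hy : (1 - s) * x + s * y0 ∈ Set.Icc (0:ℝ) 1 := by
      have := convex_Icc (0:ℝ) 1 hx hy0 (by linarith : 0 ≤ 1 - s) hs0 (by ring)
      simpa using this
    refine (h x hx _ hy).trans (ENNReal.ofReal_le_ofReal ?_)
    have hcv : F ((1 - s) * x + s * y0) ≤ (1 - s) * F x + s * a := by
      have := hF.2 (Set.mem_univ x) (Set.mem_univ y0) (by linarith : 0 ≤ 1 - s) hs0 (by ring)
      simpa using this
    have hsq : (x - ((1 - s) * x + s * y0)) ^ 2 ≤ s ^ 2 := by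
      have e : (x - ((1 - s) * x + s * y0)) ^ 2 = s ^ 2 * (x - y0) ^ 2 := by ring
      have : (x - y0) ^ 2 ≤ 1 := by
        rw [sq_le_one_iff_abs_le_one, abs_le]
        constructor <;> linarith [hx.1, hx.2, hy0.1, hy0.2]
      rw [e]; nlinarith [sq_nonneg s]
    calc _ ≤ Real.exp (a + ((F x - a) - s * (F x - a) + s ^ 2 / 2)) := by
          apply Real.exp_le_exp.2; linarith
      _ = Real.exp a * Real.exp ((F x - a) - s * (F x - a) + s ^ 2 / 2) := Real.exp_add _ _
      _ ≤ _ := by gcongr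
  have hint2 : Integrable (fun x => Real.exp a * (1 + (F x - a))) μ :=
    ((integrable_const _).add (hint.sub (integrable_const _))).const_mul _
  calc ∫⁻ x, H x ∂μ ≤ ∫⁻ x, ENNReal.ofReal (Real.exp a * (1 + (F x - a))) ∂μ := by
        apply lintegral_mono_ae
        filter_upwards [hμ] with x hx using step x hx
    _ = ENNReal.ofReal (∫ x, Real.exp a * (1 + (F x - a)) ∂μ) := by
        rw [ofReal_integral_eq_lintegral_ofReal hint2]
        filter_upwards [hμ] with x hx
        have := hmin' x hx
        exact mul_nonneg (Real.exp_pos _).le (by linarith)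
    _ ≤ _ := by
        apply ENNReal.ofReal_le_ofReal
        have e : ∫ x, Real.exp a * (1 + (F x - a)) ∂μ
            = Real.exp a * (1 + (∫ x, F x ∂μ - a)) := by
          have hi : Integrable (fun x => F x - a) μ := hint.sub (integrable_const _)
          rw [integral_const_mul, integral_add (integrable_const _) hi,
            integral_sub hint (integrable_const _)]
          simp
        rw [e]
        calc _ ≤ Real.exp a * Real.exp (∫ x, F x ∂μ - a) := by
              gcongr
              linarith [Real.add_one_le_exp (∫ x, F x ∂μ - a)]
          _ = _ := by rw [← Real.exp_add]; congr 1; ring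

lemma ae_cube {n : ℕ} (μ : Fin n → Measure ℝ) [∀ i, IsProbabilityMeasure (μ i)]
    (hμ : ∀ i, ∀ᵐ x ∂(μ i), x ∈ Set.Icc (0:ℝ) 1) :
    ∀ᵐ y ∂(Measure.pi μ), y ∈ Set.Icc (0 : Fin n → ℝ) 1 := by
  have : ∀ᵐ y ∂(Measure.pi μ), ∀ i, y i ∈ Set.Icc (0:ℝ) 1 := by
    rw [ae_all_iff]
    intro i
    exact (measurePreserving_eval μ i).quasiMeasurePreserving.ae (hμ i)
  filter_upwards [this] with y hy
  exact ⟨fun i => (hy i).1, fun i => (hy i).2⟩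

lemma cons_comb {n : ℕ} (a b x y : ℝ) (u v : Fin n → ℝ) :
    (Fin.cons (a * x + b * y) (a • u + b • v) : Fin (n+1) → ℝ)
      = a • (Fin.cons x u : Fin (n+1) → ℝ) + b • (Fin.cons y v : Fin (n+1) → ℝ) := by
  ext i
  refine Fin.cases ?_ (fun j => ?_) i <;> simp

lemma multi_dim : ∀ (n : ℕ) (μ : Fin n → Measure ℝ) [∀ i, IsProbabilityMeasure (μ i)]
    (_ : ∀ i, ∀ᵐ x ∂(μ i), x ∈ Set.Icc (0:ℝ) 1)
    (f : (Fin n → ℝ) → ℝ) (_ : ConvexOn ℝ Set.univ f) (h : (Fin n → ℝ) → ℝ≥0∞)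
    (_ : Measurable h)
    (_ : ∀ x ∈ Set.Icc (0 : Fin n → ℝ) 1, ∀ y ∈ Set.Icc (0 : Fin n → ℝ) 1,
      h x ≤ ENNReal.ofReal (Real.exp (f y + (∑ i, (x i - y i) ^ 2) / 2))),
    ∫⁻ x, h x ∂(Measure.pi μ) ≤ ENNReal.ofReal (Real.exp (∫ x, f x ∂(Measure.pi μ))) := by
  intro n
  induction n with
  | zero =>
    intro μ _ _ f _ h hh H
    rw [Measure.pi_of_empty μ 0, lintegral_dirac, integral_dirac]
    have := H 0 (by simp) 0 (by simp)
    simpa using this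
  | succ n ih =>
    intro μ _ hμ f hf h hh H
    have hfc := convex_cont hf
    let ν : Fin n → Measure ℝ := fun j => μ (Fin.succ j)
    have hν : ∀ i, ∀ᵐ x ∂(ν i), x ∈ Set.Icc (0:ℝ) 1 := fun i => hμ _
    have hνc := ae_cube ν hν
    have hmp : MeasurePreserving (MeasurableEquiv.piFinSuccAbove (fun _ => ℝ) 0).symm
        ((μ 0).prod (Measure.pi ν)) (Measure.pi μ) :=
      (measurePreserving_piFinSuccAbove μ 0).symm
    have hcons : ∀ p : ℝ × (Fin n → ℝ),
        (MeasurableEquiv.piFinSuccAbove (fun _ => ℝ) 0).symm p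
          = (Fin.cons p.1 p.2 : Fin (n+1) → ℝ) := by
      intro p
      simp [MeasurableEquiv.piFinSuccAbove, Fin.insertNthEquiv]
    have hccont : Continuous (fun p : ℝ × (Fin n → ℝ) => (Fin.cons p.1 p.2 : Fin (n+1) → ℝ)) := by
      refine continuous_pi fun i => ?_
      refine Fin.cases ?_ (fun j => ?_) i
      · simpa using continuous_fst
      · simpa [Function.comp_def] using (continuous_apply j).comp continuous_snd
    have hfint : Integrable f (Measure.pi μ) :=
      integrable_of_cpt isCompact_Icc (ae_cube μ hμ) hfc
    have e1 : ∫⁻ x, h x ∂(Measure.pi μ)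
        = ∫⁻ x, ∫⁻ z, h (Fin.cons x z) ∂(Measure.pi ν) ∂(μ 0) := by
      rw [← hmp.lintegral_comp hh]
      simp_rw [hcons]
      exact lintegral_prod _ (hh.comp hccont.measurable).aemeasurable
    have e2 : ∫ x, f x ∂(Measure.pi μ)
        = ∫ x, ∫ z, f (Fin.cons x z) ∂(Measure.pi ν) ∂(μ 0) := by
      rw [← hmp.integral_comp' f]
      have hi := (hmp.integrable_comp hfc.aestronglyMeasurable).2 hfint
      simp only [Function.comp_def, hcons] at hi
      simp_rw [hcons]
      rw [integral_prod _ hi]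
    have hsl : ∀ x : ℝ, Continuous (fun z : Fin n → ℝ => f (Fin.cons x z)) := fun x =>
      hfc.comp (hccont.comp (Continuous.prodMk continuous_const continuous_id))
    have hsli : ∀ x : ℝ, Integrable (fun z : Fin n → ℝ => f (Fin.cons x z)) (Measure.pi ν) :=
      fun x => integrable_of_cpt isCompact_Icc hνc (hsl x)
    rw [e1, e2]
    apply one_dim (μ 0) (hμ 0)
    · refine ⟨convex_univ, ?_⟩
      intro x _ y _ a b ha hb hab
      simp only [smul_eq_mul]
      rw [← integral_const_mul, ← integral_const_mul,
        ← integral_add ((hsli x).const_mul a) ((hsli y).const_mul b)]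
      apply integral_mono (hsli _) (((hsli x).const_mul a).add ((hsli y).const_mul b))
      intro z
      have := hf.2 (Set.mem_univ (Fin.cons x z : Fin (n+1) → ℝ))
        (Set.mem_univ (Fin.cons y z : Fin (n+1) → ℝ)) ha hb hab
      rw [← cons_comb, ← add_smul, hab, one_smul] at this
      simpa using this
    · intro x hx y hy
      have key := ih ν hν (fun z => f (Fin.cons y z) + (x - y) ^ 2 / 2)
        ⟨convex_univ, ?_⟩ (fun z => h (Fin.cons x z))
        (hh.comp (hccont.comp (Continuous.prodMk continuous_const continuous_id)).measurable) ?_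
      · refine key.trans_eq ?_
        rw [integral_add (hsli y) (integrable_const _)]
        simp
      · intro u _ v _ a b ha hb hab
        have := hf.2 (Set.mem_univ (Fin.cons y u : Fin (n+1) → ℝ))
          (Set.mem_univ (Fin.cons y v : Fin (n+1) → ℝ)) ha hb hab
        rw [← cons_comb, ← add_mul, hab, one_mul] at this
        simp only [smul_eq_mul] at this ⊢
        have e : (x - y) ^ 2 / 2 = a * ((x - y) ^ 2 / 2) + b * ((x - y) ^ 2 / 2) := by
          rw [← add_mul, hab, one_mul]
        linarith
      · have hm : ∀ (x : ℝ) (u : Fin n → ℝ), x ∈ Set.Icc (0:ℝ) 1 → u ∈ Set.Icc (0 : Fin n → ℝ) 1 →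
            (Fin.cons x u : Fin (n+1) → ℝ) ∈ Set.Icc (0 : Fin (n+1) → ℝ) 1 := by
          intro x u hx hu
          constructor
          · intro i
            refine Fin.cases ?_ (fun j => ?_) i
            · simpa using hx.1
            · simpa using hu.1 j
          · intro i
            refine Fin.cases ?_ (fun j => ?_) i
            · simpa using hx.2
            · simpa using hu.2 j
        intro u hu v hv
        refine (H _ (hm x u hx hu) _ (hm y v hy hv)).trans_eq ?_
        congr 2
        rw [Fin.sum_univ_succ]
        simp only [Fin.cons_zero, Fin.cons_succ]
        ring

lemma lq_ne_top (q : ℝ≥0∞) {L : ℕ} (v : Fin L → ℝ) : eLpNorm v q Measure.count ≠ ⊤ :=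
  (MemLp.of_discrete (f := v) (p := q) (μ := Measure.count)).eLpNorm_ne_top

lemma lq_nonneg (q : ℝ≥0∞) {L : ℕ} (v : Fin L → ℝ) : 0 ≤ lqNorm q v := ENNReal.toReal_nonneg

lemma lq_add {q : ℝ≥0∞} (hq : 1 ≤ q) {L : ℕ} (v w : Fin L → ℝ) :
    lqNorm q (v + w) ≤ lqNorm q v + lqNorm q w := by
  unfold lqNorm
  rw [← ENNReal.toReal_add (lq_ne_top _ _) (lq_ne_top _ _)]
  exact ENNReal.toReal_mono (ENNReal.add_ne_top.2 ⟨lq_ne_top _ _, lq_ne_top _ _⟩)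
    (eLpNorm_add_le .of_discrete .of_discrete hq)

lemma lq_smul (q : ℝ≥0∞) {L : ℕ} {c : ℝ} (hc : 0 ≤ c) (v : Fin L → ℝ) :
    lqNorm q (c • v) = c * lqNorm q v := by
  unfold lqNorm
  rw [eLpNorm_const_smul, ENNReal.toReal_mul]
  simp [abs_of_nonneg hc]

lemma lq_mono (q : ℝ≥0∞) {L : ℕ} {v w : Fin L → ℝ} (h : ∀ j, |v j| ≤ w j) :
    lqNorm q v ≤ lqNorm q w :=
  ENNReal.toReal_mono (lq_ne_top _ _) (eLpNorm_mono_real h)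

lemma f_convex {n L : ℕ} (X : Fin n → Fin L → ℝ) (gv : Fin n → ℝ) {q : ℝ≥0∞} (hq : 1 ≤ q) :
    ConvexOn ℝ Set.univ (fun y : Fin n → ℝ =>
      lqNorm q (fun j => (1 / (n : ℝ)) * ∑ i, X i j * (y i - gv i))) := by
  refine ⟨convex_univ, ?_⟩
  intro x _ y _ a b ha hb hab
  simp only [smul_eq_mul]
  rw [← lq_smul q ha, ← lq_smul q hb]
  refine le_trans (le_of_eq ?_) (lq_add hq _ _)
  congr 1
  ext j
  simp only [Pi.add_apply, Pi.smul_apply, smul_eq_mul]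
  rw [mul_left_comm a, mul_left_comm b, ← mul_add]
  congr 1
  rw [Finset.mul_sum, Finset.mul_sum, ← Finset.sum_add_distrib]
  refine Finset.sum_congr rfl fun i _ => ?_
  have : gv i = a * gv i + b * gv i := by rw [← add_mul, hab, one_mul]
  linear_combination (-X i j) * this

lemma f_lip {n L : ℕ} (X : Fin n → Fin L → ℝ) (gv : Fin n → ℝ) {q : ℝ≥0∞} (hq : 1 ≤ q)
    (x y : Fin n → ℝ) :
    lqNorm q (fun j => (1 / (n : ℝ)) * ∑ i, X i j * (x i - gv i))
      ≤ lqNorm q (fun j => (1 / (n : ℝ)) * ∑ i, X i j * (y i - gv i))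
        + √((1 / (n : ℝ)) * ∑ i, (x i - y i) ^ 2) * Nq q X := by
  unfold Nq
  rw [← lq_smul q (Real.sqrt_nonneg _)]
  have e : (fun j => (1 / (n : ℝ)) * ∑ i, X i j * (x i - gv i))
      = (fun j => (1 / (n : ℝ)) * ∑ i, X i j * (y i - gv i))
        + (fun j => (1 / (n : ℝ)) * ∑ i, X i j * (x i - y i)) := by
    ext j
    simp only [Pi.add_apply]
    rw [← mul_add, ← Finset.sum_add_distrib]
    congr 1
    exact Finset.sum_congr rfl fun i _ => by ring
  rw [e]
  refine (lq_add hq _ _).trans ?_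
  gcongr
  refine lq_mono q fun j => ?_
  simp only [Pi.smul_apply, smul_eq_mul]
  rw [← Real.sqrt_mul (by positivity)]
  apply Real.abs_le_sqrt
  have := Finset.sum_mul_sq_le_sq_mul_sq Finset.univ (fun i => X i j) (fun i => x i - y i)
  rw [mul_pow]
  calc _ ≤ (1 / (n:ℝ)) ^ 2 * ((∑ i, X i j ^ 2) * ∑ i, (x i - y i) ^ 2) := by gcongr
    _ = _ := by ring

/-- Proposition 4.1, concentration part. -/
theorem bounded_response_concentration
    (n L : ℕ) (hn : 1 ≤ n) (hL : 1 ≤ L) (X : Fin n → Fin L → ℝ)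
    (μY : Fin n → Measure ℝ) [∀ i, IsProbabilityMeasure (μY i)]
    (hsupp : ∀ i, μY i (Set.Icc (0 : ℝ) 1) = 1)
    (gv : Fin n → ℝ)
    (q : ℝ≥0∞) (hq : 1 ≤ q) (t : ℝ) (ht : 0 ≤ t) :
    ((Measure.pi μY) {y : Fin n → ℝ |
        lqNorm q (fun j => (1 / (n : ℝ)) * ∑ i, X i j * (y i - gv i))
          ≥ (∫ y', lqNorm q (fun j => (1 / (n : ℝ)) * ∑ i, X i j * (y' i - gv i))
              ∂(Measure.pi μY)) + t}).toReal
      ≤ Real.exp (-(n * t ^ 2) / (2 * (Nq q X) ^ 2)) := by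
  set f : (Fin n → ℝ) → ℝ := fun y =>
    lqNorm q (fun j => (1 / (n : ℝ)) * ∑ i, X i j * (y i - gv i)) with hf
  have hfcv : ConvexOn ℝ Set.univ f := f_convex X gv hq
  have hfc := convex_cont hfcv
  have hμ : ∀ i, ∀ᵐ x ∂(μY i), x ∈ Set.Icc (0:ℝ) 1 := fun i =>
    (mem_ae_iff_prob_eq_one measurableSet_Icc).2 (hsupp i)
  have hN0 : 0 ≤ Nq q X := lq_nonneg _ _
  have hn0 : (0:ℝ) < n := by exact_mod_cast hn
  change ((Measure.pi μY) {y | f y ≥ (∫ y', f y' ∂(Measure.pi μY)) + t}).toReal ≤ _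
  set m := ∫ y', f y' ∂(Measure.pi μY) with hm
  rcases hN0.eq_or_lt with hN | hN
  · rw [← hN]
    simp only [ne_eq, OfNat.ofNat_ne_zero, not_false_eq_true, zero_pow, mul_zero, div_zero,
      Real.exp_zero]
    exact measureReal_le_one
  set N := Nq q X with hNdef
  set l : ℝ := n * t / N ^ 2 with hl
  have hl0 : 0 ≤ l := by positivity
  set c : ℝ := l ^ 2 * (N ^ 2 / n) / 2 with hc
  have hmeas : Measurable (fun y => ENNReal.ofReal (Real.exp (l * f y - c))) := by
    have := hfc.measurable
    fun_prop
  have hmain := multi_dim n μY hμ (fun y => l * f y) (hfcv.smul hl0)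
    (fun y => ENNReal.ofReal (Real.exp (l * f y - c))) hmeas ?_
  · rw [integral_const_mul, ← hm] at hmain
    have hch := (mul_meas_ge_le_lintegral (μ := Measure.pi μY) hmeas
      (ENNReal.ofReal (Real.exp (l * (m + t) - c)))).trans hmain
    have hsub : (Measure.pi μY) {y | f y ≥ m + t} ≤ (Measure.pi μY)
        {y | ENNReal.ofReal (Real.exp (l * (m + t) - c))
          ≤ ENNReal.ofReal (Real.exp (l * f y - c))} := by
      apply measure_mono
      intro y hy
      apply ENNReal.ofReal_le_ofReal
      apply Real.exp_le_exp.2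
      have := mul_le_mul_of_nonneg_left (show m + t ≤ f y from hy) hl0
      linarith
    have h2 := (mul_le_mul_right hsub (ENNReal.ofReal (Real.exp (l * (m + t) - c)))).trans hch
    have h3 := ENNReal.toReal_mono ENNReal.ofReal_ne_top h2
    rw [ENNReal.toReal_mul, ENNReal.toReal_ofReal (Real.exp_pos _).le,
      ENNReal.toReal_ofReal (Real.exp_pos _).le, mul_comm, ← le_div_iff₀ (Real.exp_pos _),
      ← Real.exp_sub] at h3
    refine h3.trans_eq ?_
    congr 1
    rw [hc, hl]
    field_simp
    ring
  · intro x _ y _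
    apply ENNReal.ofReal_le_ofReal
    apply Real.exp_le_exp.2
    have hlip : f x ≤ f y + √((1 / (n : ℝ)) * ∑ i, (x i - y i) ^ 2) * N := f_lip X gv hq x y
    set S := ∑ i, (x i - y i) ^ 2 with hS
    have hS0 : 0 ≤ S := Finset.sum_nonneg fun i _ => sq_nonneg _
    set r := √((1 / (n : ℝ)) * S) with hr
    have hr2 : r ^ 2 = 1 / (n:ℝ) * S := Real.sq_sqrt (by positivity)
    have hS2 : S = n * r ^ 2 := by rw [hr2]; field_simp
    have h1 := mul_le_mul_of_nonneg_left hlip hl0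
    have h2 : l * (r * N) ≤ c + S / 2 := by
      rw [hS2, hc]
      have : 0 ≤ (n:ℝ) * (r - l * N / n) ^ 2 := by positivity
      have e : (n:ℝ) * (r - l * N / n) ^ 2
        = n * r ^ 2 - 2 * (l * (r * N)) + l ^ 2 * (N ^ 2 / n) := by field_simp; ring
      linarith
    linarith
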